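/- arXiv:1411.0795 — 2 statements merged into one kernel-verified Lean document; each statement's English description precedes it below -/
import Mathlib

section
/- Let n ≥ 1 and let A be a real n×n symmetric matrix. Then A is completely positive if and only if there exists a finite nonnegative Borel measure μ on ℝⁿ whose support is contained in Δ (the nonnegative part of the unit sphere) such that A_ij = ∫ x_i x_j dμ(x) for all 1 ≤ i, j ≤ n. Moreover, in that case μ can be taken to be finitely atomic. -/
open Matrix MeasureTheory BigOperators

/-- A real symmetric matrix is completely positive if `A = V * Vᵀ` for some
entrywise nonnegative matrix `V`. -/
def IsCP {n : ℕ} (A : Matrix (Fin n) (Fin n) ℝ) : Prop :=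
  ∃ (k : ℕ) (V : Matrix (Fin n) (Fin k) ℝ), (∀ i j, 0 ≤ V i j) ∧ A = V * Vᵀ

/-- `Δ`, the nonnegative part of the unit sphere in `ℝⁿ`. -/
def Delta (n : ℕ) : Set (Fin n → ℝ) :=
  {x | (∑ i, x i ^ 2 = 1) ∧ ∀ i, 0 ≤ x i}

/-- `μ` is a representing measure for `A`: a finite (nonnegative Borel) measure
concentrated on `Δ` whose second-order moments are the entries of `A`. -/
def IsRepMeasure {n : ℕ} (A : Matrix (Fin n) (Fin n) ℝ)
    (μ : Measure (Fin n → ℝ)) : Prop :=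
  IsFiniteMeasure μ ∧ μ (Delta n)ᶜ = 0 ∧ ∀ i j, A i j = ∫ x, x i * x j ∂μ

/-- In a finite-dimensional space, the convex hull of a compact set is compact. -/
theorem IsCompact.isCompact_convexHull {E : Type*} [AddCommGroup E] [Module ℝ E]
    [TopologicalSpace E] [IsTopologicalAddGroup E] [ContinuousSMul ℝ E] [FiniteDimensional ℝ E]
    {s : Set E} (hs : IsCompact s) : IsCompact (convexHull ℝ s) := by
  rcases s.eq_empty_or_nonempty with rfl | ⟨x₀, hx₀⟩
  · simp
  set d := Module.finrank ℝ E
  let F : (Fin (d + 1) → ℝ) × (Fin (d + 1) → E) → E := fun p => ∑ i, p.1 i • p.2 i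
  have hF : Continuous F := by fun_prop
  have hK : IsCompact (stdSimplex ℝ (Fin (d + 1)) ×ˢ (Set.univ.pi fun _ : Fin (d + 1) => s)) :=
    (isCompact_stdSimplex ℝ (Fin (d + 1))).prod (isCompact_univ_pi fun _ => hs)
  convert hK.image hF
  ext x
  constructor
  · intro hx
    obtain ⟨ι, _, z, w, hz, hind, hw, hw1, rfl⟩ := eq_pos_convex_span_of_mem_convexHull hx
    have hcard : Fintype.card ι ≤ Fintype.card (Fin (d + 1)) := by
      rw [Fintype.card_fin]
      exact hind.card_le_finrank_succ.trans (Nat.succ_le_succ (Submodule.finrank_le _))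
    obtain ⟨e⟩ := Function.Embedding.nonempty_of_card_le hcard
    refine ⟨(Function.extend e w 0, Function.extend e z fun _ => x₀), ⟨⟨?_, ?_⟩, ?_⟩, ?_⟩
    · intro j
      by_cases hj : ∃ i, e i = j
      · obtain ⟨i, rfl⟩ := hj
        simpa [e.injective.extend_apply] using (hw i).le
      · simp [Function.extend_apply' _ _ _ hj]
    · rw [← hw1]
      refine (Fintype.sum_of_injective e e.injective _ _ ?_ ?_).symm
      · intro j hj
        simp [Function.extend_apply' _ _ _ hj]
      · intro i
        simp [e.injective.extend_apply]
    · intro j _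
      by_cases hj : ∃ i, e i = j
      · obtain ⟨i, rfl⟩ := hj
        simpa [e.injective.extend_apply] using hz ⟨i, rfl⟩
      · simpa [Function.extend_apply' _ _ _ hj] using hx₀
    · refine (Fintype.sum_of_injective e e.injective _ _ ?_ ?_).symm
      · intro j hj
        simp [Function.extend_apply' _ _ _ hj]
      · intro i
        simp [e.injective.extend_apply]
  · rintro ⟨⟨w, z⟩, ⟨hw, hz⟩, rfl⟩
    exact mem_convexHull_of_exists_fintype w z hw.1 hw.2 (fun i => hz i trivial) rfl

theorem isClosed_Delta (n : ℕ) : IsClosed (Delta n) := by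
  have h : Delta n = {x | ∑ i, x i ^ 2 = 1} ∩ ⋂ i, {x | 0 ≤ x i} := by
    ext x
    simp [Delta]
  rw [h]
  exact (isClosed_eq (by fun_prop) continuous_const).inter
    (isClosed_iInter fun i => isClosed_le continuous_const (continuous_apply i))

theorem le_one_of_mem_Delta {n : ℕ} {x : Fin n → ℝ} (hx : x ∈ Delta n) (i : Fin n) :
    x i ≤ 1 := by
  have h : x i ^ 2 ≤ ∑ j, x j ^ 2 :=
    Finset.single_le_sum (f := fun j => x j ^ 2) (fun j _ => sq_nonneg _) (Finset.mem_univ i)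
  rw [hx.1] at h
  nlinarith [hx.2 i]

theorem isCompact_Delta (n : ℕ) : IsCompact (Delta n) :=
  (isCompact_Icc (a := (0 : Fin n → ℝ)) (b := 1)).of_isClosed_subset (isClosed_Delta n)
    fun _ hx => ⟨hx.2, le_one_of_mem_Delta hx⟩

/-- A nonnegative combination of matrices `zₜ zₜᵀ` with `zₜ ≥ 0` is completely positive. -/
theorem isCP_of_sum {n : ℕ} {ι : Type*} [Fintype ι] {A : Matrix (Fin n) (Fin n) ℝ}
    (c : ι → ℝ) (z : ι → Fin n → ℝ) (hc : ∀ t, 0 ≤ c t) (hz : ∀ t i, 0 ≤ z t i)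
    (hA : ∀ i j, A i j = ∑ t, c t * (z t i * z t j)) : IsCP A := by
  let e := Fintype.equivFin ι
  refine ⟨Fintype.card ι, Matrix.of fun i k => √(c (e.symm k)) * z (e.symm k) i,
    fun i k => mul_nonneg (Real.sqrt_nonneg _) (hz _ _), ?_⟩
  ext i j
  rw [hA, Matrix.mul_apply, ← e.symm.sum_comp]
  refine Finset.sum_congr rfl fun k _ => ?_
  rw [Matrix.transpose_apply, Matrix.of_apply, Matrix.of_apply, mul_mul_mul_comm, Real.mul_self_sqrt (hc _)]

theorem IsRepMeasure.isCP {n : ℕ} {A : Matrix (Fin n) (Fin n) ℝ} {μ : Measure (Fin n → ℝ)}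
    (h : IsRepMeasure A μ) : IsCP A := by
  obtain ⟨_, hsupp, hA⟩ := h
  have hae : ∀ᵐ x ∂μ, x ∈ Delta n := hsupp
  let f : (Fin n → ℝ) → Fin n → Fin n → ℝ := fun x i j => x i * x j
  have hf : Continuous f := by fun_prop
  have hint (i j : Fin n) : Integrable (fun x => f x i j) μ := by
    refine .of_bound (by fun_prop) 1 ?_
    filter_upwards [hae] with x hx
    rw [Real.norm_of_nonneg (mul_nonneg (hx.2 i) (hx.2 j))]
    exact mul_le_one₀ (le_one_of_mem_Delta hx i) (hx.2 j) (le_one_of_mem_Delta hx j)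
  have hfi : Integrable f μ := .of_eval fun i => .of_eval fun j => hint i j
  have hAf (i j : Fin n) : A i j = (∫ x, f x ∂μ) i j := by
    rw [hA, eval_integral (fun i => .of_eval fun j => hint i j),
      eval_integral (fun j => hint i j)]
  rcases eq_or_ne μ 0 with rfl | hμ
  · exact isCP_of_sum (ι := Empty) (fun _ => 0) (fun _ => 0) (by simp) (by simp) (by simp [hA])
  have : NeZero μ := ⟨hμ⟩
  have hmem : ⨍ x, f x ∂μ ∈ convexHull ℝ (f '' Delta n) := by
    refine (convex_convexHull ℝ _).average_mem
      ((isCompact_Delta n).image hf).isCompact_convexHull.isClosed ?_ hfi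
    filter_upwards [hae] with x hx
    exact subset_convexHull ℝ _ ⟨x, hx, rfl⟩
  obtain ⟨ι, _, w, y, hw, -, hy, hsum⟩ := mem_convexHull_iff_exists_fintype.1 hmem
  choose z hz hzy using hy
  refine isCP_of_sum (fun t => μ.real Set.univ * w t) z
    (fun t => mul_nonneg measureReal_nonneg (hw t)) (fun t => (hz t).2) fun i j => ?_
  rw [hAf, ← measure_smul_average, ← hsum]
  simp [← hzy, f, Finset.sum_apply, Finset.mul_sum, mul_assoc]

theorem IsCP.exists_finite_isRepMeasure {n : ℕ} {A : Matrix (Fin n) (Fin n) ℝ} (h : IsCP A) :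
    ∃ μ : Measure (Fin n → ℝ), IsRepMeasure A μ ∧
      ∃ S : Finset (Fin n → ℝ), μ ((S : Set (Fin n → ℝ)))ᶜ = 0 := by
  classical
  obtain ⟨k, V, hV, rfl⟩ := h
  let s : Fin k → ℝ := fun t => ∑ i, V i t ^ 2
  have hs (t : Fin k) : 0 ≤ s t := Finset.sum_nonneg fun i _ => sq_nonneg _
  let u : Fin k → Fin n → ℝ := fun t i => V i t / √(s t)
  refine ⟨∑ t, ENNReal.ofReal (s t) • Measure.dirac (u t), ⟨?_, ?_, fun i j => ?_⟩,
    Finset.univ.image u, ?_⟩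
  · have (t : Fin k) : IsFiniteMeasure (ENNReal.ofReal (s t) • Measure.dirac (u t)) :=
      Measure.smul_finite _ ENNReal.ofReal_ne_top
    infer_instance
  · rw [Measure.finsetSum_apply]
    refine Finset.sum_eq_zero fun t _ => ?_
    rcases (hs t).eq_or_lt with h0 | hpos
    · simp [← h0]
    · have hu : u t ∈ Delta n := by
        refine ⟨?_, fun i => div_nonneg (hV i t) (Real.sqrt_nonneg _)⟩
        simp only [u, div_pow, Real.sq_sqrt (hs t)]
        rw [← Finset.sum_div]
        exact div_self hpos.ne'
      simp [hu]
  · have hint (t : Fin k) : Integrable (fun x : Fin n → ℝ => x i * x j)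
        (ENNReal.ofReal (s t) • Measure.dirac (u t)) :=
      (integrable_dirac enorm_lt_top).smul_measure ENNReal.ofReal_ne_top
    rw [integral_finsetSum_measure fun t _ => hint t, Matrix.mul_apply]
    refine Finset.sum_congr rfl fun t _ => ?_
    rw [integral_smul_measure, integral_dirac, ENNReal.toReal_ofReal (hs t), smul_eq_mul,
      Matrix.transpose_apply]
    rcases (hs t).eq_or_lt with h0 | hpos
    · have hVi : V i t = 0 := by
        have := (Finset.sum_eq_zero_iff_of_nonneg fun i _ => sq_nonneg (V i t)).1 h0.symm i
          (Finset.mem_univ i)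
        simpa using this
      simp [← h0, hVi]
    · simp only [u]
      rw [div_mul_div_comm, Real.mul_self_sqrt (hs t), mul_div_cancel₀ _ hpos.ne']
  · rw [Measure.finsetSum_apply]
    refine Finset.sum_eq_zero fun t _ => ?_
    simp

theorem cp_iff_representing_measure (n : ℕ) (hn : 1 ≤ n)
    (A : Matrix (Fin n) (Fin n) ℝ) (hA : A.IsSymm) :
    (IsCP A ↔ ∃ μ : Measure (Fin n → ℝ), IsRepMeasure A μ) ∧
    (IsCP A → ∃ μ : Measure (Fin n → ℝ), IsRepMeasure A μ ∧
      ∃ S : Finset (Fin n → ℝ), μ ((S : Set (Fin n → ℝ)))ᶜ = 0) :=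
  ⟨⟨fun h => h.exists_finite_isRepMeasure.imp fun _ hμ => hμ.1, fun ⟨_, hμ⟩ => hμ.isCP⟩,
    fun h => h.exists_finite_isRepMeasure⟩
end

section
/- Theorem 3.1(ii) (primal Slater condition): with the data and problems (P), (D) as in the context, suppose there exists (X̃,γ̃) with A_i•X̃ = b_i for i = 1,…,m_e, A_i•X̃ > b_i for i = m_e+1,…,m, X̃ lying in the interior of CP_n (as a subset of S_n), and ‖X̃−C‖ < γ̃. Then the optimal value ϑ_P of (P) (the infimum of γ over primal feasible points) equals the optimal value ϑ_D of (D) (the supremum of bᵀλ + C•Z over dual feasible points); moreover, since ϑ_P is finite, there exists a dual feasible (λ*,S*,Z*) attaining ϑ_D = bᵀλ* + C•Z*; and if (X*,γ*) is a minimizer of (P), then there exists a dual feasible (λ̄,S̄,Z̄) with γ* − bᵀλ̄ − C•Z̄ = 0. -/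
open Matrix BigOperators

/-- A real symmetric matrix is copositive if `xᵀ B x ≥ 0` for all entrywise
nonnegative vectors `x`. -/
def IsCopositive {n : ℕ} (B : Matrix (Fin n) (Fin n) ℝ) : Prop :=
  ∀ x : Fin n → ℝ, (∀ i, 0 ≤ x i) → 0 ≤ x ⬝ᵥ (B *ᵥ x)

/-- The dual norm of a norm `N` on the space of symmetric matrices:
`‖A‖_* = sup { A•X : X ∈ S_n, ‖X‖ ≤ 1 }`. -/
noncomputable def dualNorm {n : ℕ} (N : Matrix (Fin n) (Fin n) ℝ → ℝ)
    (A : Matrix (Fin n) (Fin n) ℝ) : ℝ :=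
  sSup {r : ℝ | ∃ X : Matrix (Fin n) (Fin n) ℝ, X.IsSymm ∧ N X ≤ 1 ∧ r = (Aᵀ * X).trace}

/-- Feasibility for the primal problem (P): `A_i • X = b_i` for `i ≤ m_e`,
`A_i • X ≥ b_i` for `i > m_e`, `‖X - C‖ ≤ γ`, and `X ∈ CP_n`. -/
def PrimalFeasible {n m : ℕ} (me : ℕ) (C : Matrix (Fin n) (Fin n) ℝ)
    (A : Fin m → Matrix (Fin n) (Fin n) ℝ) (b : Fin m → ℝ)
    (N : Matrix (Fin n) (Fin n) ℝ → ℝ)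
    (X : Matrix (Fin n) (Fin n) ℝ) (γ : ℝ) : Prop :=
  X.IsSymm ∧ IsCP X ∧
  (∀ i : Fin m, (i : ℕ) < me → ((A i)ᵀ * X).trace = b i) ∧
  (∀ i : Fin m, me ≤ (i : ℕ) → ((A i)ᵀ * X).trace ≥ b i) ∧
  N (X - C) ≤ γ

/-- Feasibility for the dual problem (D): `∑ λ_i A_i + S + Z = 0`, `λ_i ≥ 0` for
`i > m_e`, `S ∈ COP_n`, and `‖Z‖_* ≤ 1`. -/
def DualFeasible {n m : ℕ} (me : ℕ)
    (A : Fin m → Matrix (Fin n) (Fin n) ℝ)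
    (N : Matrix (Fin n) (Fin n) ℝ → ℝ)
    (lam : Fin m → ℝ) (S Z : Matrix (Fin n) (Fin n) ℝ) : Prop :=
  (∑ i, lam i • A i) + S + Z = 0 ∧
  (∀ i : Fin m, me ≤ (i : ℕ) → 0 ≤ lam i) ∧
  S.IsSymm ∧ IsCopositive S ∧
  Z.IsSymm ∧ dualNorm N Z ≤ 1

/-- The dual objective `bᵀλ + C • Z`. -/
noncomputable def dualObj {n m : ℕ} (b : Fin m → ℝ) (C : Matrix (Fin n) (Fin n) ℝ)
    (lam : Fin m → ℝ) (Z : Matrix (Fin n) (Fin n) ℝ) : ℝ :=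
  (∑ i, b i * lam i) + (Cᵀ * Z).trace

theorem nonpos_of_forall_pos_mul_le {a B : ℝ} (h : ∀ t : ℝ, 0 < t → t * a ≤ B) : a ≤ 0 := by
  by_contra! ha
  have h1 := h ((|B| + 1) / a) (by positivity)
  rw [div_mul_cancel₀ _ ha.ne'] at h1
  linarith [le_abs_self B]

theorem le_of_forall_pos_add_mul_le {a c u : ℝ} (h : ∀ t : ℝ, 0 < t → a + t * c ≤ u) :
    a ≤ u := by
  have : a - u ≤ 0 := nonpos_of_forall_pos_mul_le (B := -c) fun t ht => by
    have h1 := mul_le_mul_of_nonneg_left (h t⁻¹ (inv_pos.2 ht)) ht.le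
    have h2 : t * (a + t⁻¹ * c) = t * a + c := by field_simp
    linarith
  linarith

theorem continuous_of_definite_seminorm {V : Type*} [AddCommGroup V] [Module ℝ V]
    [FiniteDimensional ℝ V] [TopologicalSpace V] [IsTopologicalAddGroup V]
    [ContinuousSMul ℝ V] [T2Space V] (p : Seminorm ℝ V) (hp : ∀ x, p x = 0 ↔ x = 0) :
    Continuous p := by
  obtain ⟨F, _, _, L, hL⟩ : ∃ (F : Type _) (_ : NormedAddCommGroup F) (_ : NormedSpace ℝ F)
      (L : V →ₗ[ℝ] F), ∀ v, ‖L v‖ = p v := by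
    let _ : Norm V := ⟨p⟩
    have core : NormedSpace.Core ℝ V :=
      { norm_nonneg := fun x => apply_nonneg p x
        norm_smul := fun c x => map_smul_eq_mul p c x
        norm_triangle := fun x y => map_add_le_add p x y
        norm_eq_zero_iff := hp }
    let _ : NormedAddCommGroup V := NormedAddCommGroup.ofCore core
    exact ⟨V, NormedAddCommGroup.ofCore core, NormedSpace.ofCore core,
      LinearMap.id, fun v => rfl⟩
  have h := (LinearMap.continuous_of_finiteDimensional L).norm
  simpa only [hL] using h

theorem exists_le_mul_of_definite_seminorm {V : Type*} [AddCommGroup V] [Module ℝ V]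
    [FiniteDimensional ℝ V] (p : Seminorm ℝ V) (hp : ∀ x, p x = 0 ↔ x = 0)
    (f : V →ₗ[ℝ] ℝ) : ∃ B : ℝ, ∀ x, f x ≤ B * p x := by
  let _ : Norm V := ⟨p⟩
  have core : NormedSpace.Core ℝ V :=
    { norm_nonneg := fun x => apply_nonneg p x
      norm_smul := fun c x => map_smul_eq_mul p c x
      norm_triangle := fun x y => map_add_le_add p x y
      norm_eq_zero_iff := hp }
  let _ : NormedAddCommGroup V := NormedAddCommGroup.ofCore core
  let _ : NormedSpace ℝ V := NormedSpace.ofCore core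
  exact ⟨‖LinearMap.toContinuousLinearMap f‖, fun x =>
    (le_abs_self _).trans ((LinearMap.toContinuousLinearMap f).le_opNorm x)⟩

theorem add_mem_interior_of_add_mem {E : Type*} [AddCommGroup E] [TopologicalSpace E]
    [IsTopologicalAddGroup E] {K : Set E} (hadd : ∀ x ∈ K, ∀ y ∈ K, x + y ∈ K)
    {x y : E} (hx : x ∈ interior K) (hy : y ∈ K) : x + y ∈ interior K := by
  have h : IsOpen ((fun z => z + y) '' interior K) :=
    (Homeomorph.addRight y).isOpenMap _ isOpen_interior
  refine interior_maximal ?_ h ⟨x, hx, rfl⟩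
  rintro _ ⟨z, hz, rfl⟩
  exact hadd z (interior_subset hz) y hy

theorem smul_mem_interior_of_smul_mem {E : Type*} [AddCommGroup E] [Module ℝ E]
    [TopologicalSpace E] [ContinuousSMul ℝ E] {K : Set E}
    (hsmul : ∀ c : ℝ, 0 < c → ∀ x ∈ K, c • x ∈ K)
    {x : E} (hx : x ∈ interior K) {c : ℝ} (hc : 0 < c) : c • x ∈ interior K := by
  have h : IsOpen ((fun z => c • z) '' interior K) :=
    (Homeomorph.smulOfNeZero c hc.ne').isOpenMap _ isOpen_interior
  refine interior_maximal ?_ h ⟨x, hx, rfl⟩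
  rintro _ ⟨z, hz, rfl⟩
  exact hsmul c hc z (interior_subset hz)

section Lagrange

variable {E : Type*} [AddCommGroup E] [Module ℝ E] [TopologicalSpace E]
  [IsTopologicalAddGroup E] [ContinuousSMul ℝ E]

/-- The separation step: a normalized functional separating the strict epigraph region of
`p (y - c)` from the affine space of points with `x = y`, value `θ` and zero slack. -/
theorem exists_separating_functional {ι κ : Type*} [Fintype κ]
    {K : Set E} (hK : Convex ℝ K) (p : Seminorm ℝ E) (hp : Continuous p) (c : E)
    (a : ι → E →ₗ[ℝ] ℝ) (b : ι → ℝ) (d : κ → E →ₗ[ℝ] ℝ) (hd : ∀ j, Continuous (d j))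
    (e : κ → ℝ) (θ : ℝ)
    (hθ : ∀ x ∈ K, (∀ i, a i x = b i) → (∀ j, e j ≤ d j x) → θ ≤ p (x - c))
    {x₀ : E} (hx₀ : x₀ ∈ interior K) (ha₀ : ∀ i, a i x₀ = b i) (hd₀ : ∀ j, e j < d j x₀) :
    ∃ (f : E × E × ℝ × (κ → ℝ) →ₗ[ℝ] ℝ) (u : ℝ), f (0, 0, 1, 0) = -1 ∧
      (∀ x y s w, x ∈ interior K → p (y - c) < s → (∀ j, w j < d j x - e j) →
        f (x, y, s, w) < u) ∧
      (∀ x, (∀ i, a i x = b i) → u ≤ f (x, x, θ, 0)) := by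
  let Ω : Set (E × E × ℝ × (κ → ℝ)) :=
    {q | q.1 ∈ interior K ∧ p (q.2.1 - c) < q.2.2.1 ∧ ∀ j, q.2.2.2 j < d j q.1 - e j}
  let T : Set (E × E × ℝ × (κ → ℝ)) :=
    {q | (∀ i, a i q.1 = b i) ∧ q.2.1 = q.1 ∧ q.2.2.1 = θ ∧ q.2.2.2 = 0}
  have hΩo : IsOpen Ω := by
    have h1 : IsOpen {q : E × E × ℝ × (κ → ℝ) | p (q.2.1 - c) < q.2.2.1} :=
      isOpen_lt (by fun_prop) (by fun_prop)
    have h2 : ∀ j, IsOpen {q : E × E × ℝ × (κ → ℝ) | q.2.2.2 j < d j q.1 - e j} := fun j =>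
      isOpen_lt (by fun_prop) (((hd j).comp continuous_fst).sub continuous_const)
    convert ((isOpen_interior (s := K)).preimage continuous_fst).inter
      (h1.inter (isOpen_iInter_of_finite h2)) using 1
    ext q
    simp [Ω]
  have hΩc : Convex ℝ Ω := by
    rintro ⟨x, y, s, w⟩ ⟨h1, h2, h3⟩ ⟨x', y', s', w'⟩ ⟨h1', h2', h3'⟩ α β hα hβ hαβ
    dsimp only at h1 h2 h3 h1' h2' h3'
    refine ⟨hK.interior h1 h1' hα hβ hαβ, ?_, fun j => ?_⟩
    · have h : α • y + β • y' - c = α • (y - c) + β • (y' - c) := by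
        have hc : c = α • c + β • c := by rw [← add_smul, hαβ, one_smul]
        nth_rewrite 1 [hc]
        module
      have h4 := map_add_le_add p (α • (y - c)) (β • (y' - c))
      rw [map_smul_eq_mul, map_smul_eq_mul, Real.norm_of_nonneg hα, Real.norm_of_nonneg hβ] at h4
      simp only [Prod.smul_mk, Prod.mk_add_mk, h, smul_eq_mul]
      refine h4.trans_lt ?_
      rcases hα.eq_or_lt with rfl | hα'
      · obtain rfl : β = 1 := by linarith
        linarith
      · have := mul_lt_mul_of_pos_left h2 hα'
        have := mul_le_mul_of_nonneg_left h2'.le hβ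
        linarith
    · simp only [Prod.smul_mk, Prod.mk_add_mk, smul_eq_mul, Pi.add_apply, Pi.smul_apply,
        map_add, map_smul]
      have h5 : e j = α * e j + β * e j := by rw [← add_mul, hαβ, one_mul]
      rw [h5]
      rcases hα.eq_or_lt with rfl | hα'
      · obtain rfl : β = 1 := by linarith
        linarith [h3' j]
      · have := mul_lt_mul_of_pos_left (h3 j) hα'
        have := mul_le_mul_of_nonneg_left (h3' j).le hβ
        linarith
  have hTc : Convex ℝ T := by
    rintro ⟨x, y, s, w⟩ ⟨h1, h2, h3, h4⟩ ⟨x', y', s', w'⟩ ⟨h1', h2', h3', h4'⟩ α β hα hβ hαβ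
    dsimp only at h1 h2 h3 h4 h1' h2' h3' h4'
    subst h2 h3 h4 h2' h3' h4'
    refine ⟨fun i => ?_, rfl, ?_, by simp⟩
    · simp only [Prod.smul_mk, Prod.mk_add_mk, map_add, map_smul, h1, h1', smul_eq_mul]
      rw [← add_mul, hαβ, one_mul]
    · simp only [Prod.smul_mk, Prod.mk_add_mk, smul_eq_mul]
      rw [← add_mul, hαβ, one_mul]
  have hdisj : Disjoint Ω T := by
    rw [Set.disjoint_left]
    rintro ⟨x, y, s, w⟩ ⟨h1, h2, h3⟩ ⟨h1', h2', h3', h4'⟩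
    dsimp only at h1 h2 h3 h1' h2' h3' h4'
    subst h2' h3' h4'
    refine absurd h2 (not_lt.2 (hθ _ (interior_subset h1) h1' fun j => ?_))
    have := h3 j
    simp only [Pi.zero_apply] at this
    linarith
  obtain ⟨f, u, hfΩ, hfT⟩ := geometric_hahn_banach_open hΩc hΩo hTc hdisj
  have hα : f (0, 0, 1, 0) < 0 := by
    have h1 := hfΩ (x₀, x₀, max (p (x₀ - c)) θ + 1, 0)
      ⟨hx₀, by dsimp only; linarith [le_max_left (p (x₀ - c)) θ], fun j => by
        simpa using hd₀ j⟩
    have h2 := hfT (x₀, x₀, θ, 0) ⟨ha₀, rfl, rfl, rfl⟩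
    have h3 : ((x₀, x₀, max (p (x₀ - c)) θ + 1, 0) : E × E × ℝ × (κ → ℝ)) =
        (x₀, x₀, θ, 0) + (max (p (x₀ - c)) θ + 1 - θ) • (0, 0, 1, 0) := by
      simp
    rw [h3, map_add, map_smul, smul_eq_mul] at h1
    have h4 : 0 < max (p (x₀ - c)) θ + 1 - θ := by linarith [le_max_right (p (x₀ - c)) θ]
    by_contra! h5
    have := mul_nonneg h4.le h5
    linarith
  set q := -f (0, 0, 1, 0) with hq
  have hqpos : 0 < q⁻¹ := inv_pos.2 (by linarith)
  refine ⟨q⁻¹ • (f : E × E × ℝ × (κ → ℝ) →ₗ[ℝ] ℝ), q⁻¹ * u, ?_, fun x y s w h1 h2 h3 => ?_,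
    fun x hx => ?_⟩
  · have : f (0, 0, 1, 0) = -q := by rw [hq, neg_neg]
    simp only [LinearMap.smul_apply, ContinuousLinearMap.coe_coe, this, smul_eq_mul]
    have : q ≠ 0 := by linarith
    field_simp
  · exact mul_lt_mul_of_pos_left (hfΩ (x, y, s, w) ⟨h1, h2, h3⟩) hqpos
  · exact mul_le_mul_of_nonneg_left (hfT (x, x, θ, 0) ⟨hx, rfl, rfl, rfl⟩) hqpos.le

/-- Lagrange multipliers for minimizing a distance `p (x - c)` over a convex cone under linear
equality and inequality constraints, assuming Slater's condition. -/
theorem exists_lagrange_multipliers {ι κ : Type*} [Fintype ι] [Fintype κ]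
    {K : Set E} (hadd : ∀ x ∈ K, ∀ y ∈ K, x + y ∈ K)
    (hsmul : ∀ t : ℝ, 0 < t → ∀ x ∈ K, t • x ∈ K)
    (p : Seminorm ℝ E) (hp : Continuous p) (c : E)
    (a : ι → E →ₗ[ℝ] ℝ) (b : ι → ℝ) (d : κ → E →ₗ[ℝ] ℝ) (hd : ∀ j, Continuous (d j))
    (e : κ → ℝ) (θ : ℝ)
    (hθ : ∀ x ∈ K, (∀ i, a i x = b i) → (∀ j, e j ≤ d j x) → θ ≤ p (x - c))
    {x₀ : E} (hx₀ : x₀ ∈ interior K) (ha₀ : ∀ i, a i x₀ = b i) (hd₀ : ∀ j, e j < d j x₀) :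
    ∃ (μ : ι → ℝ) (β : κ → ℝ) (g : E →ₗ[ℝ] ℝ), (∀ j, 0 ≤ β j) ∧ (∀ x, g x ≤ p x) ∧
      (∀ x ∈ K, ∑ i, μ i * a i x + ∑ j, β j * d j x + g x ≤ 0) ∧
      θ ≤ ∑ i, μ i * b i + ∑ j, β j * e j + g c := by
  classical
  have hK : Convex ℝ K := by
    intro x hx y hy s t hs ht hst
    rcases hs.eq_or_lt with rfl | hs
    · obtain rfl : t = 1 := by linarith
      simpa using hy
    rcases ht.eq_or_lt with rfl | ht
    · obtain rfl : s = 1 := by linarith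
      simpa using hx
    exact hadd _ (hsmul s hs x hx) _ (hsmul t ht y hy)
  obtain ⟨f, u, hf1, hfΩ, hfT⟩ :=
    exists_separating_functional hK p hp c a b d hd e θ hθ hx₀ ha₀ hd₀
  let G : E →ₗ[ℝ] ℝ := f ∘ₗ LinearMap.inl ℝ E (E × ℝ × (κ → ℝ))
  let H : E →ₗ[ℝ] ℝ := f ∘ₗ LinearMap.inr ℝ E (E × ℝ × (κ → ℝ)) ∘ₗ
    LinearMap.inl ℝ E (ℝ × (κ → ℝ))
  let W : (κ → ℝ) →ₗ[ℝ] ℝ := f ∘ₗ LinearMap.inr ℝ E (E × ℝ × (κ → ℝ)) ∘ₗ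
    LinearMap.inr ℝ E (ℝ × (κ → ℝ)) ∘ₗ LinearMap.inr ℝ ℝ (κ → ℝ)
  have hf : ∀ x y s w, f (x, y, s, w) = G x + H y - s + W w := by
    intro x y s w
    have h : ((x, y, s, w) : E × E × ℝ × (κ → ℝ)) =
        (x, 0, 0, 0) + (0, y, 0, 0) + s • (0, 0, 1, 0) + (0, 0, 0, w) := by simp
    rw [h, map_add, map_add, map_add, map_smul, hf1]
    change f (x, 0, 0, 0) + f (0, y, 0, 0) + s * (-1) + f (0, 0, 0, w) =
      f (x, 0, 0, 0) + f (0, y, 0, 0) - s + f (0, 0, 0, w)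
    ring
  simp only [hf] at hfΩ hfT
  let β : κ → ℝ := fun j => W (Pi.single j 1)
  have hW : ∀ w, W w = ∑ j, w j * β j := by
    intro w
    rw [LinearMap.pi_apply_eq_sum_univ W w]
    refine Finset.sum_congr rfl fun j _ => ?_
    rw [smul_eq_mul]
    congr 2
    ext k
    simp [Pi.single_apply, eq_comm]
  have hβ : ∀ j, 0 ≤ β j := by
    intro j
    suffices -β j ≤ 0 by linarith
    refine nonpos_of_forall_pos_mul_le
      (B := u - (G x₀ + H x₀ - (p (x₀ - c) + 1))) fun t ht => ?_
    have h := hfΩ x₀ x₀ (p (x₀ - c) + 1) (-t • Pi.single j 1) hx₀ (by linarith) fun k => by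
      have h1 : (0 : ℝ) ≤ t * (Pi.single j 1 : κ → ℝ) k := by
        refine mul_nonneg ht.le ?_
        rw [Pi.single_apply]
        split_ifs <;> norm_num
      simp only [Pi.smul_apply, smul_eq_mul]
      linarith [hd₀ k]
    rw [map_smul, smul_eq_mul] at h
    change _ + -t * β j < u at h
    linarith
  have key : ∀ x ∈ interior K, ∀ y,
      G x + H y - p (y - c) + ∑ j, (d j x - e j) * β j ≤ u := by
    intro x hx y
    refine le_of_forall_pos_add_mul_le (c := -1 - ∑ j, β j) fun t ht => ?_
    have h := hfΩ x y (p (y - c) + t) (fun j => d j x - e j - t) hx (by linarith)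
      fun j => by linarith
    rw [hW] at h
    have h2 : ∑ j, (d j x - e j - t) * β j = ∑ j, (d j x - e j) * β j - t * ∑ j, β j := by
      rw [Finset.mul_sum, ← Finset.sum_sub_distrib]
      exact Finset.sum_congr rfl fun j _ => by ring
    rw [h2] at h
    linarith
  obtain ⟨μ, hμ⟩ : ∃ μ : ι → ℝ, ∀ x, G x + H x = ∑ i, μ i * a i x := by
    have hker : ∀ v, (∀ i, a i v = 0) → (G + H) v ≤ 0 := by
      intro v hv
      refine nonpos_of_forall_pos_mul_le (B := G x₀ + H x₀ - θ - u) fun t ht => ?_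
      have h := hfT (x₀ + (-t) • v) fun i => by simp [hv, ha₀]
      simp only [map_add, map_smul, map_zero, smul_eq_mul] at h
      simp only [LinearMap.add_apply]
      linarith
    have hspan : G + H ∈ Submodule.span ℝ (Set.range a) := by
      refine mem_span_of_iInf_ker_le_ker fun v hv => ?_
      simp only [Submodule.mem_iInf, LinearMap.mem_ker] at hv
      rw [LinearMap.mem_ker]
      refine le_antisymm (hker v hv) ?_
      have := hker (-v) fun i => by simp [hv]
      rw [map_neg] at this
      linarith
    obtain ⟨μ, hμ⟩ := (Submodule.mem_span_range_iff_exists_fun ℝ).1 hspan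
    refine ⟨μ, fun x => ?_⟩
    have := LinearMap.congr_fun hμ x
    simpa using this.symm
  have hHp : ∀ v, H v ≤ p v := by
    intro v
    suffices H v - p v ≤ 0 by linarith
    refine nonpos_of_forall_pos_mul_le
      (B := u - G x₀ - H c - ∑ j, (d j x₀ - e j) * β j) fun t ht => ?_
    have h := key x₀ hx₀ (c + t • v)
    rw [add_sub_cancel_left, map_smul_eq_mul, Real.norm_of_nonneg ht.le, map_add, map_smul,
      smul_eq_mul] at h
    linarith
  have hsum : ∀ x, ∑ j, (d j x - e j) * β j = ∑ j, β j * d j x - ∑ j, β j * e j := by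
    intro x
    rw [← Finset.sum_sub_distrib]
    exact Finset.sum_congr rfl fun j _ => by ring
  have keyc : ∀ x ∈ interior K,
      G x + H c + ∑ j, β j * d j x - ∑ j, β j * e j ≤ u := by
    intro x hx
    have h := key x hx c
    rw [sub_self, map_zero, hsum] at h
    linarith
  have hlin : ∀ (x : E) (t : ℝ), ∑ j, β j * d j (t • x) = t * ∑ j, β j * d j x := by
    intro x t
    rw [Finset.mul_sum]
    refine Finset.sum_congr rfl fun j _ => ?_
    rw [map_smul, smul_eq_mul]
    ring
  refine ⟨μ, β, -H, hβ, fun x => ?_, fun x hx => ?_, ?_⟩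
  · simpa using hHp (-x)
  · rw [← hμ, LinearMap.neg_apply]
    suffices G x + ∑ j, β j * d j x ≤ 0 by linarith
    refine nonpos_of_forall_pos_mul_le
      (B := u - (G x₀ + H c + ∑ j, β j * d j x₀ - ∑ j, β j * e j)) fun t ht => ?_
    have h := keyc (x₀ + t • x) (add_mem_interior_of_add_mem hadd hx₀ (hsmul t ht x hx))
    simp only [map_add, mul_add, Finset.sum_add_distrib, hlin] at h
    rw [map_smul, smul_eq_mul] at h
    linarith
  · have h1 : H c - ∑ j, β j * e j ≤ u := by
      refine le_of_forall_pos_add_mul_le (c := G x₀ + ∑ j, β j * d j x₀) fun t ht => ?_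
      have h := keyc (t • x₀) (smul_mem_interior_of_smul_mem hsmul hx₀ ht)
      rw [hlin, map_smul, smul_eq_mul] at h
      linarith
    have h2 := hfT x₀ ha₀
    rw [hμ, map_zero] at h2
    simp only [ha₀] at h2
    rw [LinearMap.neg_apply]
    linarith

end Lagrange

theorem IsCP.add {n : ℕ} {X Y : Matrix (Fin n) (Fin n) ℝ} (hX : IsCP X) (hY : IsCP Y) :
    IsCP (X + Y) := by
  obtain ⟨k, V, hV, rfl⟩ := hX
  obtain ⟨l, W, hW, rfl⟩ := hY
  refine ⟨k + l, Matrix.of fun i => Fin.append (V i) (W i), fun i j => ?_, ?_⟩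
  · refine Fin.addCases (fun a => ?_) (fun a => ?_) j <;> simp [hV, hW]
  · ext i j
    simp [Matrix.mul_apply, Fin.sum_univ_add]

theorem IsCP.smul {n : ℕ} {X : Matrix (Fin n) (Fin n) ℝ} (hX : IsCP X) {t : ℝ} (ht : 0 ≤ t) :
    IsCP (t • X) := by
  obtain ⟨k, V, hV, rfl⟩ := hX
  refine ⟨k, Real.sqrt t • V, fun i j => mul_nonneg (Real.sqrt_nonneg t) (hV i j), ?_⟩
  rw [Matrix.transpose_smul, Matrix.smul_mul, Matrix.mul_smul, smul_smul, Real.mul_self_sqrt ht]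

theorem isCP_vecMulVec {n : ℕ} {x : Fin n → ℝ} (hx : ∀ i, 0 ≤ x i) :
    IsCP (Matrix.vecMulVec x x) := by
  refine ⟨1, Matrix.of fun i _ => x i, fun i _ => hx i, ?_⟩
  ext i j
  simp [Matrix.mul_apply, Matrix.vecMulVec_apply]

theorem trace_transpose_mul_vecMulVec {n : ℕ} (S : Matrix (Fin n) (Fin n) ℝ) (x : Fin n → ℝ) :
    (Sᵀ * Matrix.vecMulVec x x).trace = x ⬝ᵥ (S *ᵥ x) := by
  simp only [Matrix.trace, Matrix.diag_apply, Matrix.mul_apply, Matrix.transpose_apply,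
    Matrix.vecMulVec_apply, dotProduct, Matrix.mulVec, Finset.mul_sum]
  rw [Finset.sum_comm]
  exact Finset.sum_congr rfl fun i _ => Finset.sum_congr rfl fun j _ => by ring

theorem IsCopositive.trace_mul_nonneg {n : ℕ} {S X : Matrix (Fin n) (Fin n) ℝ}
    (hS : IsCopositive S) (hX : IsCP X) : 0 ≤ (Sᵀ * X).trace := by
  obtain ⟨k, V, hV, rfl⟩ := hX
  have h : V * Vᵀ = ∑ l, Matrix.vecMulVec (fun i => V i l) (fun i => V i l) := by
    ext i j
    simp [Matrix.mul_apply, Matrix.sum_apply, Matrix.vecMulVec_apply]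
  rw [h, Matrix.mul_sum, Matrix.trace_sum]
  refine Finset.sum_nonneg fun l _ => ?_
  rw [trace_transpose_mul_vecMulVec]
  exact hS _ fun i => hV i l

/-- The space of real symmetric matrices. -/
def symmetricMatrices (n : ℕ) : Submodule ℝ (Matrix (Fin n) (Fin n) ℝ) where
  carrier := {M | M.IsSymm}
  add_mem' := fun hX hY => Matrix.IsSymm.add hX hY
  zero_mem' := Matrix.isSymm_zero
  smul_mem' := fun c _ hX => Matrix.IsSymm.smul hX c

/-- The functional `X ↦ M • X` on symmetric matrices. -/
def traceFunctional {n : ℕ} (M : Matrix (Fin n) (Fin n) ℝ) : symmetricMatrices n →ₗ[ℝ] ℝ :=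
  Matrix.traceLinearMap (Fin n) ℝ ℝ ∘ₗ LinearMap.mulLeft ℝ Mᵀ ∘ₗ (symmetricMatrices n).subtype

theorem traceFunctional_apply {n : ℕ} (M : Matrix (Fin n) (Fin n) ℝ)
    (X : symmetricMatrices n) : traceFunctional M X = (Mᵀ * X.1).trace := rfl

theorem exists_isSymm_traceFunctional_eq {n : ℕ} (g : symmetricMatrices n →ₗ[ℝ] ℝ) :
    ∃ Z : Matrix (Fin n) (Fin n) ℝ, Z.IsSymm ∧ ∀ X, g X = traceFunctional Z X := by
  have hmem : ∀ i j : Fin n, Matrix.single i j (1 : ℝ) + Matrix.single j i 1 ∈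
      symmetricMatrices n := by
    intro i j
    change (Matrix.single i j (1 : ℝ) + Matrix.single j i 1).IsSymm
    rw [Matrix.IsSymm, Matrix.transpose_add, Matrix.transpose_single, Matrix.transpose_single,
      add_comm]
  let u : Fin n → Fin n → symmetricMatrices n := fun i j => ⟨_, hmem i j⟩
  refine ⟨Matrix.of fun i j => g (u i j) / 2, ?_, fun X => ?_⟩
  · ext i j
    simp only [Matrix.transpose_apply, Matrix.of_apply]
    congr 2
    exact Subtype.ext (add_comm _ _)
  · have hX : X = ∑ j, ∑ i, (X.1 i j / 2) • u i j := by
      refine Subtype.ext ?_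
      have h1 : X.1 = ∑ i, ∑ j, Matrix.single i j (X.1 i j) := Matrix.matrix_eq_sum_single X.1
      have h2 : X.1 = ∑ j, ∑ i, Matrix.single j i (X.1 i j) := by
        conv_lhs => rw [← (show X.1ᵀ = X.1 from X.2), Matrix.matrix_eq_sum_single X.1ᵀ]
        rfl
      rw [Finset.sum_comm] at h1
      have h3 : X.1 = (2⁻¹ : ℝ) • (X.1 + X.1) := by
        rw [← two_smul ℝ X.1, smul_smul]; norm_num
      refine h3.trans ((congrArg₂ (fun M M' => (2⁻¹ : ℝ) • (M + M')) h1 h2).trans ?_)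
      simp only [← Finset.sum_add_distrib, Finset.smul_sum, Submodule.coe_sum,
        Submodule.coe_smul, u]
      refine Finset.sum_congr rfl fun j _ => Finset.sum_congr rfl fun i _ => ?_
      simp [Matrix.smul_single, smul_add, div_eq_inv_mul]
    conv_lhs => rw [hX]
    simp only [map_sum, map_smul, traceFunctional_apply, Matrix.trace, Matrix.diag_apply,
      Matrix.mul_apply, Matrix.transpose_apply, Matrix.of_apply, smul_eq_mul]
    exact Finset.sum_congr rfl fun j _ => Finset.sum_congr rfl fun i _ => by ring

/-- A norm on symmetric matrices, bundled as a seminorm. -/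
def symmetricSeminorm {n : ℕ} (N : Matrix (Fin n) (Fin n) ℝ → ℝ)
    (hNsmul : ∀ (c : ℝ) (X : Matrix (Fin n) (Fin n) ℝ), X.IsSymm → N (c • X) = |c| * N X)
    (hNadd : ∀ X Y : Matrix (Fin n) (Fin n) ℝ, X.IsSymm → Y.IsSymm →
      N (X + Y) ≤ N X + N Y) : Seminorm ℝ (symmetricMatrices n) :=
  Seminorm.of (fun X => N X.1) (fun X Y => hNadd X.1 Y.1 X.2 Y.2)
    (fun c X => hNsmul c X.1 X.2)

theorem trace_mul_le_of_dualNorm_le_one {n : ℕ} {N : Matrix (Fin n) (Fin n) ℝ → ℝ}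
    (p : Seminorm ℝ (symmetricMatrices n)) (hp : ∀ X, p X = 0 ↔ X = 0)
    (hpN : ∀ X : symmetricMatrices n, p X = N X.1) {Z : Matrix (Fin n) (Fin n) ℝ}
    (hZ : dualNorm N Z ≤ 1) {X : Matrix (Fin n) (Fin n) ℝ} (hX : X.IsSymm) :
    (Zᵀ * X).trace ≤ N X := by
  obtain ⟨B, hB⟩ := exists_le_mul_of_definite_seminorm p hp (traceFunctional Z)
  have hbdd : BddAbove {r : ℝ | ∃ X : Matrix (Fin n) (Fin n) ℝ,
      X.IsSymm ∧ N X ≤ 1 ∧ r = (Zᵀ * X).trace} := by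
    refine ⟨|B|, ?_⟩
    rintro _ ⟨Y, hY, hY1, rfl⟩
    have h1 := hB ⟨Y, hY⟩
    have h2 : p ⟨Y, hY⟩ ≤ 1 := (hpN _).trans_le hY1
    have h3 : B * p ⟨Y, hY⟩ ≤ |B| * p ⟨Y, hY⟩ :=
      mul_le_mul_of_nonneg_right (le_abs_self B) (apply_nonneg p _)
    exact h1.trans (h3.trans (mul_le_of_le_one_right (abs_nonneg B) h2))
  let x : symmetricMatrices n := ⟨X, hX⟩
  change traceFunctional Z x ≤ N x.1
  rw [← hpN]
  rcases (apply_nonneg p x).eq_or_lt with h0 | hpos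
  · rw [(hp x).1 h0.symm, map_zero, map_zero]
  · have h1 : traceFunctional Z ((p x)⁻¹ • x) ≤ 1 := by
      refine (le_csSup hbdd ⟨((p x)⁻¹ • x).1, ((p x)⁻¹ • x).2, ?_, rfl⟩).trans hZ
      rw [← hpN, map_smul_eq_mul, Real.norm_of_nonneg (inv_nonneg.2 hpos.le),
        inv_mul_cancel₀ hpos.ne']
    rw [map_smul, smul_eq_mul, inv_mul_le_iff₀ hpos, mul_one] at h1
    exact h1

theorem trace_transpose_add_mul {n : ℕ} (M M' X : Matrix (Fin n) (Fin n) ℝ) :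
    ((M + M')ᵀ * X).trace = (Mᵀ * X).trace + (M'ᵀ * X).trace := by
  rw [Matrix.transpose_add, Matrix.add_mul, Matrix.trace_add]

theorem trace_transpose_sum_smul_mul {n m : ℕ} (A : Fin m → Matrix (Fin n) (Fin n) ℝ)
    (lam : Fin m → ℝ) (X : Matrix (Fin n) (Fin n) ℝ) :
    ((∑ i, lam i • A i)ᵀ * X).trace = ∑ i, lam i * ((A i)ᵀ * X).trace := by
  rw [Matrix.transpose_sum, Matrix.sum_mul, Matrix.trace_sum]
  refine Finset.sum_congr rfl fun i _ => ?_
  rw [Matrix.transpose_smul, Matrix.smul_mul, Matrix.trace_smul, smul_eq_mul]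

theorem trace_transpose_mul_comm {n : ℕ} (C Z : Matrix (Fin n) (Fin n) ℝ) :
    (Cᵀ * Z).trace = (Zᵀ * C).trace := by
  rw [← Matrix.trace_transpose, Matrix.transpose_mul, Matrix.transpose_transpose]

/-- Weak duality between (P) and (D). -/
theorem dualObj_le_of_feasible {n m me : ℕ} {C : Matrix (Fin n) (Fin n) ℝ} (hC : C.IsSymm)
    {A : Fin m → Matrix (Fin n) (Fin n) ℝ} {b : Fin m → ℝ}
    {N : Matrix (Fin n) (Fin n) ℝ → ℝ}
    (p : Seminorm ℝ (symmetricMatrices n)) (hp : ∀ X, p X = 0 ↔ X = 0)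
    (hpN : ∀ X : symmetricMatrices n, p X = N X.1)
    {X : Matrix (Fin n) (Fin n) ℝ} {γ : ℝ} (hX : PrimalFeasible me C A b N X γ)
    {lam : Fin m → ℝ} {S Z : Matrix (Fin n) (Fin n) ℝ} (hD : DualFeasible me A N lam S Z) :
    dualObj b C lam Z ≤ γ := by
  obtain ⟨hXs, hXcp, hXeq, hXge, hXγ⟩ := hX
  obtain ⟨hsum, hlam, -, hScop, -, hZ1⟩ := hD
  have h1 := hScop.trace_mul_nonneg hXcp
  have h2 : ∑ i, lam i * ((A i)ᵀ * X).trace + (Sᵀ * X).trace + (Zᵀ * X).trace = 0 := by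
    rw [← trace_transpose_sum_smul_mul, ← trace_transpose_add_mul, ← trace_transpose_add_mul,
      hsum, Matrix.transpose_zero, Matrix.zero_mul, Matrix.trace_zero]
  have h3 : ∑ i, b i * lam i ≤ ∑ i, lam i * ((A i)ᵀ * X).trace := by
    refine Finset.sum_le_sum fun i _ => ?_
    rw [mul_comm]
    rcases lt_or_ge (i : ℕ) me with hi | hi
    · rw [hXeq i hi]
    · exact mul_le_mul_of_nonneg_left (hXge i hi) (hlam i hi)
  have h4 := trace_mul_le_of_dualNorm_le_one p hp hpN hZ1 (hXs.sub hC).neg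
  have h5 : N (-(X - C)) = N (X - C) := by
    have := map_neg_eq_map p ⟨X - C, hXs.sub hC⟩
    rwa [hpN, hpN] at this
  rw [h5, Matrix.mul_neg, Matrix.trace_neg, Matrix.mul_sub, Matrix.trace_sub] at h4
  rw [dualObj, trace_transpose_mul_comm]
  linarith

theorem exists_dualFeasible_ge {n m me : ℕ} {C : Matrix (Fin n) (Fin n) ℝ} (hC : C.IsSymm)
    {A : Fin m → Matrix (Fin n) (Fin n) ℝ} (hA : ∀ i, (A i).IsSymm) {b : Fin m → ℝ}
    {N : Matrix (Fin n) (Fin n) ℝ → ℝ}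
    (p : Seminorm ℝ (symmetricMatrices n)) (hp : ∀ X, p X = 0 ↔ X = 0)
    (hpN : ∀ X : symmetricMatrices n, p X = N X.1) {θ : ℝ}
    (hθ : ∀ X γ, PrimalFeasible me C A b N X γ → θ ≤ γ)
    {X₀ : symmetricMatrices n}
    (hX₀ : X₀ ∈ interior {X : symmetricMatrices n | IsCP X.1})
    (heq : ∀ i : Fin m, (i : ℕ) < me → ((A i)ᵀ * X₀.1).trace = b i)
    (hgt : ∀ i : Fin m, me ≤ (i : ℕ) → ((A i)ᵀ * X₀.1).trace > b i) :
    ∃ lam S Z, DualFeasible me A N lam S Z ∧ θ ≤ dualObj b C lam Z := by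
  obtain ⟨μ, β, g, hβ, hgp, hcone, hval⟩ := exists_lagrange_multipliers
    (ι := {i : Fin m // (i : ℕ) < me}) (κ := {i : Fin m // ¬ (i : ℕ) < me})
    (K := {X : symmetricMatrices n | IsCP X.1})
    (fun _ hX _ hY => IsCP.add hX hY) (fun t ht _ hX => IsCP.smul hX ht.le)
    p (continuous_of_definite_seminorm p hp) ⟨C, hC⟩
    (fun i => traceFunctional (A i)) (fun i => b i)
    (fun i => traceFunctional (A i)) (fun i => LinearMap.continuous_of_finiteDimensional _)
    (fun i => b i) θ
    (fun X hX hXeq hXge => hθ X.1 _ ⟨X.2, hX, fun i hi => hXeq ⟨i, hi⟩,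
      fun i hi => hXge ⟨i, not_lt.2 hi⟩, (hpN (X - ⟨C, hC⟩)).ge⟩)
    hX₀ (fun i => heq i i.2) (fun i => hgt i (not_lt.1 i.2))
  obtain ⟨Z, hZs, hZ⟩ := exists_isSymm_traceFunctional_eq g
  let lam : Fin m → ℝ := fun i => if h : (i : ℕ) < me then μ ⟨i, h⟩ else β ⟨i, h⟩
  have hlam : ∀ r : Fin m → ℝ, ∑ i, lam i * r i = ∑ i : {i : Fin m // (i : ℕ) < me}, μ i * r i +
      ∑ i : {i : Fin m // ¬ (i : ℕ) < me}, β i * r i := by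
    intro r
    rw [← Fintype.sum_subtype_add_sum_subtype (fun i : Fin m => (i : ℕ) < me)]
    congr 1
    · exact Finset.sum_congr rfl fun i _ => by simp only [lam, dif_pos i.2]
    · exact Finset.sum_congr rfl fun i _ => by simp only [lam, dif_neg i.2]
  have hsymm : (∑ i, lam i • A i).IsSymm :=
    (symmetricMatrices n).sum_mem fun i _ => (symmetricMatrices n).smul_mem _ (hA i)
  refine ⟨lam, -(∑ i, lam i • A i + Z), Z, ⟨by abel, fun i hi => ?_, (hsymm.add hZs).neg,
    fun x hx => ?_, hZs, ?_⟩, ?_⟩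
  · simp only [lam, dif_neg (not_lt.2 hi)]
    exact hβ _
  · have hcp := isCP_vecMulVec hx
    have hs : (Matrix.vecMulVec x x).IsSymm := by
      ext i j
      simp [Matrix.vecMulVec_apply, mul_comm]
    have h := hcone ⟨_, hs⟩ hcp
    rw [← hlam fun i => traceFunctional (A i) ⟨_, hs⟩, hZ] at h
    simp only [traceFunctional_apply] at h
    rw [← trace_transpose_sum_smul_mul, ← trace_transpose_add_mul,
      trace_transpose_mul_vecMulVec] at h
    rw [Matrix.neg_mulVec, dotProduct_neg]
    linarith
  · refine Real.sSup_le ?_ zero_le_one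
    rintro _ ⟨X, hX, hX1, rfl⟩
    exact ((hZ ⟨X, hX⟩).ge.trans ((hgp _).trans_eq (hpN _))).trans hX1
  · rw [← hlam b, hZ, traceFunctional_apply] at hval
    rw [dualObj, trace_transpose_mul_comm]
    simpa only [mul_comm] using hval

theorem primal_slater_strong_duality (n m me : ℕ) (hn : 1 ≤ n) (hme : me ≤ m)
    (C : Matrix (Fin n) (Fin n) ℝ) (hC : C.IsSymm)
    (A : Fin m → Matrix (Fin n) (Fin n) ℝ) (hA : ∀ i, (A i).IsSymm)
    (b : Fin m → ℝ)
    (N : Matrix (Fin n) (Fin n) ℝ → ℝ)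
    -- `N` is a norm on the space `S_n` of symmetric matrices:
    (hN0 : ∀ X : Matrix (Fin n) (Fin n) ℝ, X.IsSymm → (N X = 0 ↔ X = 0))
    (hNsmul : ∀ (c : ℝ) (X : Matrix (Fin n) (Fin n) ℝ), X.IsSymm → N (c • X) = |c| * N X)
    (hNadd : ∀ X Y : Matrix (Fin n) (Fin n) ℝ, X.IsSymm → Y.IsSymm →
      N (X + Y) ≤ N X + N Y)
    -- the primal Slater point:
    (Xt : Matrix (Fin n) (Fin n) ℝ) (γt : ℝ) (hXtsymm : Xt.IsSymm)
    (hXteq : ∀ i : Fin m, (i : ℕ) < me → ((A i)ᵀ * Xt).trace = b i)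
    (hXtineq : ∀ i : Fin m, me ≤ (i : ℕ) → ((A i)ᵀ * Xt).trace > b i)
    (hXtint : (⟨Xt, hXtsymm⟩ : {M : Matrix (Fin n) (Fin n) ℝ // M.IsSymm}) ∈
      interior {p : {M : Matrix (Fin n) (Fin n) ℝ // M.IsSymm} | IsCP p.1})
    (hXtnorm : N (Xt - C) < γt) :
    -- strong duality: ϑ_P = ϑ_D
    sInf {γ : ℝ | ∃ X : Matrix (Fin n) (Fin n) ℝ, PrimalFeasible me C A b N X γ}
      = sSup {v : ℝ | ∃ (lam : Fin m → ℝ) (S Z : Matrix (Fin n) (Fin n) ℝ),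
          DualFeasible me A N lam S Z ∧ v = dualObj b C lam Z} ∧
    -- dual attainment (ϑ_P is finite):
    (∃ (lams : Fin m → ℝ) (Ss Zs : Matrix (Fin n) (Fin n) ℝ),
      DualFeasible me A N lams Ss Zs ∧
      dualObj b C lams Zs
        = sSup {v : ℝ | ∃ (lam : Fin m → ℝ) (S Z : Matrix (Fin n) (Fin n) ℝ),
            DualFeasible me A N lam S Z ∧ v = dualObj b C lam Z}) ∧
    -- zero gap at any primal minimizer:
    (∀ (Xs : Matrix (Fin n) (Fin n) ℝ) (γs : ℝ),
      PrimalFeasible me C A b N Xs γs →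
      (∀ (X : Matrix (Fin n) (Fin n) ℝ) (γ : ℝ),
          PrimalFeasible me C A b N X γ → γs ≤ γ) →
      ∃ (lamb : Fin m → ℝ) (Sb Zb : Matrix (Fin n) (Fin n) ℝ),
        DualFeasible me A N lamb Sb Zb ∧ γs - dualObj b C lamb Zb = 0) := by
  let p := symmetricSeminorm N hNsmul hNadd
  have hpN : ∀ X : symmetricMatrices n, p X = N X.1 := fun _ => rfl
  have hp : ∀ X : symmetricMatrices n, p X = 0 ↔ X = 0 := fun X =>
    (hN0 X.1 X.2).trans Submodule.coe_eq_zero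
  set P := {γ : ℝ | ∃ X : Matrix (Fin n) (Fin n) ℝ, PrimalFeasible me C A b N X γ}
  have hXtcp : (⟨Xt, hXtsymm⟩ : {M : Matrix (Fin n) (Fin n) ℝ // M.IsSymm}) ∈
      {p : {M : Matrix (Fin n) (Fin n) ℝ // M.IsSymm} | IsCP p.1} := interior_subset hXtint
  have hPne : P.Nonempty := ⟨γt, Xt, hXtsymm, hXtcp, hXteq,
    fun i hi => (hXtineq i hi).le, hXtnorm.le⟩
  have hPbdd : BddBelow P := by
    refine ⟨0, ?_⟩
    rintro γ ⟨X, hX⟩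
    exact (apply_nonneg p ⟨X - C, hX.1.sub hC⟩).trans hX.2.2.2.2
  obtain ⟨lam, S, Z, hD, hle⟩ := exists_dualFeasible_ge (me := me) (θ := sInf P) hC hA p hp hpN
    (fun X γ hX => csInf_le hPbdd ⟨X, hX⟩) (X₀ := ⟨Xt, hXtsymm⟩) hXtint hXteq hXtineq
  have hweak : ∀ lam S Z, DualFeasible me A N lam S Z → dualObj b C lam Z ≤ sInf P := by
    intro lam S Z hD
    refine le_csInf hPne ?_
    rintro γ ⟨X, hX⟩
    exact dualObj_le_of_feasible hC p hp hpN hX hD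
  have hval : dualObj b C lam Z = sInf P := le_antisymm (hweak _ _ _ hD) hle
  have hmax : IsGreatest {v : ℝ | ∃ (lam : Fin m → ℝ) (S Z : Matrix (Fin n) (Fin n) ℝ),
      DualFeasible me A N lam S Z ∧ v = dualObj b C lam Z} (sInf P) := by
    refine ⟨⟨lam, S, Z, hD, hval.symm⟩, ?_⟩
    rintro _ ⟨lam', S', Z', hD', rfl⟩
    exact hweak _ _ _ hD'
  rw [hmax.csSup_eq]
  refine ⟨rfl, ⟨lam, S, Z, hD, hval⟩, fun Xs γs hXs hmin => ⟨lam, S, Z, hD, ?_⟩⟩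
  have hγ : IsLeast P γs := ⟨⟨Xs, hXs⟩, by
    rintro γ ⟨X, hX⟩
    exact hmin X γ hX⟩
  rw [hval, hγ.csInf_eq, sub_self]
end
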